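/- Let ρ be a normalized state on registers A, B, C and let α ∈ (0,1)∪(1,∞). Let ω'_A be a normalized state achieving inf over normalized σ_A of D_α(ρ_AC‖σ_A⊗𝟙_C); define ν_AC = (ρ_AC^{1/2}(ω'_A⊗𝟙_C)^{(1−α)/α}ρ_AC^{1/2})^α / Tr[(ρ_AC^{1/2}(ω'_A⊗𝟙_C)^{(1−α)/α}ρ_AC^{1/2})^α] and ν_ABC = ν_AC^{1/2}·ρ_{B|AC}·ν_AC^{1/2}. Then (i) H_α↑(C|AB)_ρ ≥ H_α↑(C|A)_ρ − I_α↓(AC;B)_ν. (ii) Moreover, if ρ' is a normalized state on R, A, C and 𝒩: R → B is a quantum channel with ρ_ABC = 𝒩(ρ'_RAC), then H_α↑(C|AB)_{𝒩(ρ')} ≥ H_α↑(C|A)_{ρ'} − sup over normalized states ω on R, A, C of I_α↓(AC;B)_{𝒩(ω)}. -/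

import Mathlib

open scoped Kronecker
open Matrix
open scoped ComplexOrder

noncomputable section
namespace QITLeak

variable {A B : Type*}

/-- Real matrix power via spectral decomposition (Moore–Penrose pseudoinverse powers,
since `(0:ℝ) ^ (p:ℝ) = 0` for `p ≠ 0`). Junk value `0` on non-Hermitian input. -/
noncomputable def mpow [Fintype A] [DecidableEq A] (ρ : Matrix A A ℂ) (p : ℝ) :
    Matrix A A ℂ :=
  if hρ : ρ.IsHermitian then
    (hρ.eigenvectorUnitary : Matrix A A ℂ) *
      Matrix.diagonal (fun i => ((hρ.eigenvalues i ^ p : ℝ) : ℂ)) *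
      (star (hρ.eigenvectorUnitary : Matrix A A ℂ))
  else 0

/-- A normalized state (density matrix). -/
def IsState [Fintype A] (ρ : Matrix A A ℂ) : Prop := ρ.PosSemidef ∧ ρ.trace = 1

/-- A subnormalized state. -/
def IsSubState [Fintype A] (ρ : Matrix A A ℂ) : Prop := ρ.PosSemidef ∧ (ρ.trace).re ≤ 1

/-- Partial trace over the second tensor factor. -/
def ptB [Fintype B] (ρ : Matrix (A × B) (A × B) ℂ) : Matrix A A ℂ :=
  Matrix.of fun a a' => ∑ b, ρ (a, b) (a', b)

/-- Partial trace over the first tensor factor. -/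
def ptA [Fintype A] (ρ : Matrix (A × B) (A × B) ℂ) : Matrix B B ℂ :=
  Matrix.of fun b b' => ∑ a, ρ (a, b) (a, b')

/-- Partial trace over the factor `B`, along a decomposition `X ≃ A × B` of the registers. -/
def traceOut {X A B : Type*} [Fintype B] (e : X ≃ A × B) (ρ : Matrix X X ℂ) :
    Matrix A A ℂ :=
  Matrix.of fun a a' => ∑ b, ρ (e.symm (a, b)) (e.symm (a', b))

/-- Support inclusion `supp ρ ⊆ supp σ` (for PSD matrices: kernel inclusion). -/
def suppSubset [Fintype A] (ρ σ : Matrix A A ℂ) : Prop :=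
  ∀ v : A → ℂ, σ *ᵥ v = 0 → ρ *ᵥ v = 0

/-- The real-valued core formula of the sandwiched Rényi divergence (base 2). -/
def DR (α : ℝ) [Fintype A] [DecidableEq A] (ρ σ : Matrix A A ℂ) : ℝ :=
  (α - 1)⁻¹ * Real.logb 2
    (((mpow (mpow σ ((1 - α) / (2 * α)) * ρ * mpow σ ((1 - α) / (2 * α))) α).trace.re)
      / (ρ.trace).re)

open scoped Classical in
/-- The sandwiched Rényi divergence `D_α(ρ‖σ)`, with value `⊤` outside the
support/orthogonality conditions. -/
def D (α : ℝ) [Fintype A] [DecidableEq A] (ρ σ : Matrix A A ℂ) : EReal :=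
  if (α < 1 ∧ ¬ (ρ * σ = 0 ∧ σ * ρ = 0)) ∨ suppSubset ρ σ then ((DR α ρ σ : ℝ) : EReal)
  else ⊤

/-- The max-divergence `D_∞(ρ‖σ)`: log of the least `μ ≥ 0` with `ρ ≤ μσ` (`⊤` if none). -/
def Dmax [Fintype A] (ρ σ : Matrix A A ℂ) : EReal :=
  sInf {x : EReal | ∃ μ : ℝ, 0 ≤ μ ∧ (μ • σ - ρ).PosSemidef ∧ x = ((Real.logb 2 μ : ℝ) : EReal)}

section Ent
variable [Fintype A] [DecidableEq A] [Fintype B] [DecidableEq B]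

/-- `H_α↑(A|B)_ρ` for `ρ` on `A × B`. -/
def HUp (α : ℝ) (ρ : Matrix (A × B) (A × B) ℂ) : EReal :=
  - sInf {x : EReal | ∃ σ : Matrix B B ℂ, IsState σ ∧ x = D α ρ ((1 : Matrix A A ℂ) ⊗ₖ σ)}

/-- `H_α(A|B)_ρ` for `ρ` on `A × B`. -/
def Hdn (α : ℝ) (ρ : Matrix (A × B) (A × B) ℂ) : EReal :=
  - D α ρ ((1 : Matrix A A ℂ) ⊗ₖ ptA ρ)

/-- `I_α↓(A;B)_ρ` for `ρ` on `A × B`. -/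
def Idown (α : ℝ) (ρ : Matrix (A × B) (A × B) ℂ) : EReal :=
  sInf {x : EReal | ∃ σ : Matrix B B ℂ, IsState σ ∧ x = D α ρ ((ptB ρ) ⊗ₖ σ)}

/-- `I_α(A:B)_ρ` for `ρ` on `A × B`. -/
def Imut (α : ℝ) (ρ : Matrix (A × B) (A × B) ℂ) : EReal :=
  D α ρ ((ptB ρ) ⊗ₖ (ptA ρ))

/-- `I_α↓↓(A:B)_ρ` for `ρ` on `A × B`. -/
def Idd (α : ℝ) (ρ : Matrix (A × B) (A × B) ℂ) : EReal :=
  sInf {x : EReal | ∃ (ω : Matrix A A ℂ) (σ : Matrix B B ℂ),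
    IsState ω ∧ IsState σ ∧ x = D α ρ (ω ⊗ₖ σ)}

/-- `H_min↑(A|B)_ρ = H_∞↑(A|B)_ρ`. -/
def HminUp (ρ : Matrix (A × B) (A × B) ℂ) : EReal :=
  - sInf {x : EReal | ∃ σ : Matrix B B ℂ, IsState σ ∧ x = Dmax ρ ((1 : Matrix A A ℂ) ⊗ₖ σ)}

/-- `I_∞↓(A;B)_ρ`. -/
def ImaxD (ρ : Matrix (A × B) (A × B) ℂ) : EReal :=
  sInf {x : EReal | ∃ σ : Matrix B B ℂ, IsState σ ∧ x = Dmax ρ ((ptB ρ) ⊗ₖ σ)}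

/-- `I_∞(A:B)_ρ` (unoptimized max-information). -/
def ImaxND (ρ : Matrix (A × B) (A × B) ℂ) : EReal :=
  Dmax ρ ((ptB ρ) ⊗ₖ (ptA ρ))

/-- `I_∞↓↓(A:B)_ρ`. -/
def IddMax (ρ : Matrix (A × B) (A × B) ℂ) : EReal :=
  sInf {x : EReal | ∃ (ω : Matrix A A ℂ) (σ : Matrix B B ℂ),
    IsState ω ∧ IsState σ ∧ x = Dmax ρ (ω ⊗ₖ σ)}

end Ent

/-- Trace norm. -/
def traceNorm [Fintype A] [DecidableEq A] (M : Matrix A A ℂ) : ℝ :=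
  (mpow (Mᴴ * M) (1 / 2 : ℝ)).trace.re

/-- Generalized fidelity of subnormalized states. -/
def gFid [Fintype A] [DecidableEq A] (ρ σ : Matrix A A ℂ) : ℝ :=
  traceNorm (mpow ρ (1 / 2 : ℝ) * mpow σ (1 / 2 : ℝ)) +
    Real.sqrt ((1 - ρ.trace.re) * (1 - σ.trace.re))

/-- Purified distance. -/
def pDist [Fintype A] [DecidableEq A] (ρ σ : Matrix A A ℂ) : ℝ :=
  Real.sqrt (1 - gFid ρ σ ^ 2)

section Smooth
variable [Fintype A] [DecidableEq A] [Fintype B] [DecidableEq B]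

/-- Smoothed min-entropy `H_min↑,ε(A|B)_ρ`. -/
def HminUpEps (ε : ℝ) (ρ : Matrix (A × B) (A × B) ℂ) : EReal :=
  sSup {x : EReal | ∃ ρ' : Matrix (A × B) (A × B) ℂ,
    IsSubState ρ' ∧ pDist ρ' ρ ≤ ε ∧ x = HminUp ρ'}

/-- Smoothed max-information `I_max↓,ε(A;B)_ρ`. -/
def ImaxDEps (ε : ℝ) (ρ : Matrix (A × B) (A × B) ℂ) : EReal :=
  sInf {x : EReal | ∃ ρ' : Matrix (A × B) (A × B) ℂ,
    IsSubState ρ' ∧ pDist ρ' ρ ≤ ε ∧ x = ImaxD ρ'}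

/-- Smoothed (unoptimized) max-information `I_max^ε(A:B)_ρ`. -/
def ImaxNDEps (ε : ℝ) (ρ : Matrix (A × B) (A × B) ℂ) : EReal :=
  sInf {x : EReal | ∃ ρ' : Matrix (A × B) (A × B) ℂ,
    IsSubState ρ' ∧ pDist ρ' ρ ≤ ε ∧ x = ImaxND ρ'}

/-- Smoothed max-information `I_max↓↓,ε(A:B)_ρ`. -/
def IddMaxEps (ε : ℝ) (ρ : Matrix (A × B) (A × B) ℂ) : EReal :=
  sInf {x : EReal | ∃ ρ' : Matrix (A × B) (A × B) ℂ,
    IsSubState ρ' ∧ pDist ρ' ρ ≤ ε ∧ x = IddMax ρ'}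

/-- Smoothed Rényi conditional entropy `H_α↑,ε(A|B)_ρ`. -/
def HUpEps (α ε : ℝ) (ρ : Matrix (A × B) (A × B) ℂ) : EReal :=
  sSup {x : EReal | ∃ ρ' : Matrix (A × B) (A × B) ℂ,
    IsSubState ρ' ∧ pDist ρ' ρ ≤ ε ∧ x = HUp α ρ'}

end Smooth

/-- Extension `id_R ⊗ Φ` of a linear map on matrices, with a spectator register on the left. -/
def lext {R A B : Type*} (Φ : Matrix A A ℂ →ₗ[ℂ] Matrix B B ℂ) :
    Matrix (R × A) (R × A) ℂ →ₗ[ℂ] Matrix (R × B) (R × B) ℂ where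
  toFun ρ := Matrix.of fun p q => Φ (Matrix.of fun a a' => ρ (p.1, a) (q.1, a')) p.2 q.2
  map_add' x y := by
    ext p q
    show Φ ((Matrix.of fun a a' => x (p.1, a) (q.1, a'))
        + (Matrix.of fun a a' => y (p.1, a) (q.1, a'))) p.2 q.2 = _
    rw [map_add]; rfl
  map_smul' c x := by
    ext p q
    show Φ (c • (Matrix.of fun a a' => x (p.1, a) (q.1, a'))) p.2 q.2 = _
    rw [_root_.map_smul]; rfl

/-- Extension `Φ ⊗ id_R` of a linear map on matrices, with a spectator register on the right. -/
def rext {A B R : Type*} (Φ : Matrix A A ℂ →ₗ[ℂ] Matrix B B ℂ) :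
    Matrix (A × R) (A × R) ℂ →ₗ[ℂ] Matrix (B × R) (B × R) ℂ where
  toFun ρ := Matrix.of fun p q => Φ (Matrix.of fun a a' => ρ (a, p.2) (a', q.2)) p.1 q.1
  map_add' x y := by
    ext p q
    show Φ ((Matrix.of fun a a' => x (a, p.2) (a', q.2))
        + (Matrix.of fun a a' => y (a, p.2) (a', q.2))) p.1 q.1 = _
    rw [map_add]; rfl
  map_smul' c x := by
    ext p q
    show Φ (c • (Matrix.of fun a a' => x (a, p.2) (a', q.2))) p.1 q.1 = _
    rw [_root_.map_smul]; rfl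

/-- Completely positive trace-preserving map (quantum channel). -/
structure IsCPTP {A B : Type*} [Fintype A] [Fintype B]
    (Φ : Matrix A A ℂ →ₗ[ℂ] Matrix B B ℂ) : Prop where
  cp : ∀ (n : ℕ) (ρ : Matrix (Fin n × A) (Fin n × A) ℂ), ρ.PosSemidef →
    ((lext Φ) ρ).PosSemidef
  tp : ∀ ρ : Matrix A A ℂ, (Φ ρ).trace = ρ.trace

/-- The rank-one (pure) state associated to a vector. -/
def pureState {A : Type*} (ψ : A → ℂ) : Matrix A A ℂ := Matrix.vecMulVec ψ (star ψ)


/-! ## Statement 8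
`H_α↑(C|AB)_ρ ≥ H_α↑(C|A)_ρ − I_α↓(AC;B)_ν`, and the channel-relaxed version.
The tripartite state is arranged on `(A × C) × B`. -/

/-- Register shuffle `(A × C) × B ≃ C × (A × B)`. -/
def eC_AB (A B C : Type*) : (A × C) × B ≃ C × (A × B) where
  toFun x := (x.1.2, (x.1.1, x.2))
  invFun y := ((y.2.1, y.1), y.2.2)
  left_inv _ := rfl
  right_inv _ := rfl


set_option linter.unusedSectionVars false

section SpectralPowers

variable {m n : Type*} [Fintype m] [DecidableEq m] [Fintype n] [DecidableEq n]

/-- The matrix `U diag(f) Uᴴ`. -/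
def conjDiag (U : Matrix n n ℂ) (f : n → ℝ) : Matrix n n ℂ :=
  U * Matrix.diagonal (fun i => (f i : ℂ)) * Uᴴ

lemma conjDiag_mul {U : Matrix n n ℂ} (hU : Uᴴ * U = 1) (f g : n → ℝ) :
    conjDiag U f * conjDiag U g = conjDiag U (fun i => f i * g i) := by
  have h : conjDiag U f * conjDiag U g = U * Matrix.diagonal (fun i => (f i : ℂ)) * (Uᴴ * U) *
      Matrix.diagonal (fun i => (g i : ℂ)) * Uᴴ := by
    simp only [conjDiag, Matrix.mul_assoc]
  rw [h, hU, Matrix.mul_one, Matrix.mul_assoc U, Matrix.diagonal_mul_diagonal]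
  simp [conjDiag]

lemma conjDiag_isHermitian (U : Matrix n n ℂ) (f : n → ℝ) : (conjDiag U f).IsHermitian := by
  unfold conjDiag
  rw [Matrix.IsHermitian, Matrix.conjTranspose_mul, Matrix.conjTranspose_mul,
    Matrix.conjTranspose_conjTranspose, Matrix.diagonal_conjTranspose, Matrix.mul_assoc]
  congr 3
  ext i
  simp

lemma conjDiag_posSemidef (U : Matrix n n ℂ) {f : n → ℝ} (hf : ∀ i, 0 ≤ f i) :
    (conjDiag U f).PosSemidef := by
  refine Matrix.PosSemidef.mul_mul_conjTranspose_same (Matrix.PosSemidef.diagonal ?_) U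
  intro i
  simpa using hf i

/-- Functional calculus does not depend on the chosen diagonalization. -/
lemma conjDiag_comp_eq {U V : Matrix n n ℂ} (hU : U * Uᴴ = 1) (hU' : Uᴴ * U = 1)
    (hV : V * Vᴴ = 1) (hV' : Vᴴ * V = 1) {d e : n → ℝ} (h : conjDiag U d = conjDiag V e)
    (f : ℝ → ℝ) : conjDiag U (fun i => f (d i)) = conjDiag V (fun i => f (e i)) := by
  have h1 : (Vᴴ * U) * Matrix.diagonal (fun i => (d i : ℂ))
      = Matrix.diagonal (fun i => (e i : ℂ)) * (Vᴴ * U) := by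
    have := congrArg (fun M => Vᴴ * M * U) h
    simp only [conjDiag] at this
    calc _ = Vᴴ * (U * Matrix.diagonal (fun i => (d i : ℂ)) * Uᴴ) * U := by
            simp only [Matrix.mul_assoc, hU', Matrix.mul_one]
      _ = _ := this
      _ = (Vᴴ * V) * Matrix.diagonal (fun i => (e i : ℂ)) * (Vᴴ * U) := by
            simp only [Matrix.mul_assoc]
      _ = _ := by rw [hV', Matrix.one_mul]
  have h2 : (Vᴴ * U) * Matrix.diagonal (fun i => (f (d i) : ℂ))
      = Matrix.diagonal (fun i => (f (e i) : ℂ)) * (Vᴴ * U) := by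
    ext i j
    have h3 := congrFun (congrFun h1 i) j
    rw [Matrix.mul_diagonal, Matrix.diagonal_mul] at h3 ⊢
    by_cases hz : (Vᴴ * U) i j = 0
    · simp [hz]
    · rw [mul_comm] at h3
      have h4 : d j = e i := by exact_mod_cast mul_right_cancel₀ hz h3
      rw [h4, mul_comm]
  have h5 := congrArg (fun M => V * M * Uᴴ) h2
  simp only [conjDiag]
  calc _ = (V * Vᴴ) * U * Matrix.diagonal (fun i => (f (d i) : ℂ)) * Uᴴ := by
          rw [hV, Matrix.one_mul]
    _ = V * (Vᴴ * U * Matrix.diagonal (fun i => (f (d i) : ℂ))) * Uᴴ := by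
          simp only [Matrix.mul_assoc]
    _ = _ := h5
    _ = V * Matrix.diagonal (fun i => (f (e i) : ℂ)) * Vᴴ * (U * Uᴴ) := by
          simp only [Matrix.mul_assoc]
    _ = _ := by rw [hU, Matrix.mul_one]

lemma mpow_eq_conjDiag {ρ : Matrix n n ℂ} (hρ : ρ.IsHermitian) (p : ℝ) :
    mpow ρ p = conjDiag (hρ.eigenvectorUnitary : Matrix n n ℂ) (fun i => hρ.eigenvalues i ^ p) := by
  rw [mpow, dif_pos hρ]
  rfl

lemma eq_conjDiag {ρ : Matrix n n ℂ} (hρ : ρ.IsHermitian) :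
    ρ = conjDiag (hρ.eigenvectorUnitary : Matrix n n ℂ) hρ.eigenvalues := by
  conv_lhs => rw [hρ.spectral_theorem, Unitary.conjStarAlgAut_apply]
  rfl

lemma mpow_conjDiag {U : Matrix n n ℂ} (hU : U * Uᴴ = 1) (hU' : Uᴴ * U = 1) (d : n → ℝ) (p : ℝ) :
    mpow (conjDiag U d) p = conjDiag U (fun i => d i ^ p) := by
  have hH := conjDiag_isHermitian U d
  rw [mpow_eq_conjDiag hH]
  exact conjDiag_comp_eq (Unitary.coe_mul_star_self hH.eigenvectorUnitary)
    (Unitary.coe_star_mul_self hH.eigenvectorUnitary) hU hU' (eq_conjDiag hH).symm (fun x => x ^ p)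

lemma exists_conjDiag {ρ : Matrix n n ℂ} (hρ : ρ.PosSemidef) :
    ∃ (U : Matrix n n ℂ) (d : n → ℝ), U * Uᴴ = 1 ∧ Uᴴ * U = 1 ∧ (∀ i, 0 ≤ d i) ∧
      ρ = conjDiag U d :=
  ⟨_, _, Unitary.coe_mul_star_self hρ.1.eigenvectorUnitary,
    Unitary.coe_star_mul_self hρ.1.eigenvectorUnitary, hρ.eigenvalues_nonneg, eq_conjDiag hρ.1⟩

lemma mpow_posSemidef {ρ : Matrix n n ℂ} (hρ : ρ.PosSemidef) (p : ℝ) : (mpow ρ p).PosSemidef := by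
  rw [mpow_eq_conjDiag hρ.1]
  exact conjDiag_posSemidef _ fun i => Real.rpow_nonneg (hρ.eigenvalues_nonneg i) _

lemma mpow_one {ρ : Matrix n n ℂ} (hρ : ρ.PosSemidef) : mpow ρ 1 = ρ := by
  obtain ⟨U, d, hU, hU', hd, rfl⟩ := exists_conjDiag hρ
  simp [mpow_conjDiag hU hU']

lemma mpow_mul_mpow {ρ : Matrix n n ℂ} (hρ : ρ.PosSemidef) {p q r : ℝ} (h : p + q = r)
    (hr : r ≠ 0) : mpow ρ p * mpow ρ q = mpow ρ r := by
  obtain ⟨U, d, hU, hU', hd, rfl⟩ := exists_conjDiag hρ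
  subst h
  simp only [mpow_conjDiag hU hU', conjDiag_mul hU']
  congr 1
  ext i
  rw [Real.rpow_add' (hd i) hr]

lemma mpow_mpow {ρ : Matrix n n ℂ} (hρ : ρ.PosSemidef) (p q : ℝ) :
    mpow (mpow ρ p) q = mpow ρ (p * q) := by
  obtain ⟨U, d, hU, hU', hd, rfl⟩ := exists_conjDiag hρ
  simp only [mpow_conjDiag hU hU', Real.rpow_mul (hd _)]

lemma mpow_smul {ρ : Matrix n n ℂ} (hρ : ρ.PosSemidef) {c : ℝ} (hc : 0 ≤ c) (p : ℝ) :
    mpow ((c : ℂ) • ρ) p = ((c ^ p : ℝ) : ℂ) • mpow ρ p := by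
  obtain ⟨U, d, hU, hU', hd, rfl⟩ := exists_conjDiag hρ
  have h : ∀ (c : ℝ) (d : n → ℝ), (c : ℂ) • conjDiag U d = conjDiag U (fun i => c * d i) := by
    intro c d
    have h : (fun i => ((c * d i : ℝ) : ℂ)) = (c : ℂ) • fun i => (d i : ℂ) := by ext; simp
    rw [conjDiag, conjDiag, h, Matrix.diagonal_smul, Matrix.mul_smul, Matrix.smul_mul]
  simp only [h, mpow_conjDiag hU hU', Real.mul_rpow hc (hd _)]

lemma mpow_zero_matrix {p : ℝ} (hp : p ≠ 0) : mpow (0 : Matrix n n ℂ) p = 0 := by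
  have h := mpow_smul (n := n) Matrix.PosSemidef.zero le_rfl (c := 0) p
  simpa [Real.zero_rpow hp] using h

lemma mpow_kronecker {ρ : Matrix m m ℂ} {σ : Matrix n n ℂ} (hρ : ρ.PosSemidef)
    (hσ : σ.PosSemidef) (p : ℝ) : mpow (ρ ⊗ₖ σ) p = mpow ρ p ⊗ₖ mpow σ p := by
  obtain ⟨U, d, hU, hU', hd, rfl⟩ := exists_conjDiag hρ
  obtain ⟨V, e, hV, hV', he, rfl⟩ := exists_conjDiag hσ
  have h : ∀ (d : m → ℝ) (e : n → ℝ), conjDiag U d ⊗ₖ conjDiag V e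
      = conjDiag (U ⊗ₖ V) (fun i => d i.1 * e i.2) := by
    intro d e
    simp only [conjDiag, Matrix.mul_kronecker_mul, Matrix.conjTranspose_kronecker,
      Matrix.diagonal_kronecker_diagonal, Complex.ofReal_mul]
  rw [h, mpow_conjDiag, mpow_conjDiag hU hU', mpow_conjDiag hV hV', h]
  · simp only [Real.mul_rpow (hd _) (he _)]
  · rw [Matrix.conjTranspose_kronecker, ← Matrix.mul_kronecker_mul, hU, hV,
      Matrix.one_kronecker_one]
  · rw [Matrix.conjTranspose_kronecker, ← Matrix.mul_kronecker_mul, hU', hV',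
      Matrix.one_kronecker_one]

lemma mpow_reindex {ρ : Matrix m m ℂ} (hρ : ρ.PosSemidef) (e : m ≃ n) (p : ℝ) :
    mpow (Matrix.reindex e e ρ) p = Matrix.reindex e e (mpow ρ p) := by
  obtain ⟨U, d, hU, hU', hd, rfl⟩ := exists_conjDiag hρ
  have h : ∀ d : m → ℝ, Matrix.reindex e e (conjDiag U d)
      = conjDiag (Matrix.reindex e e U) (d ∘ e.symm) := by
    intro d
    simp only [conjDiag, Matrix.reindex_apply, Matrix.conjTranspose_submatrix]
    rw [show Matrix.diagonal (fun i => ((d ∘ e.symm) i : ℂ))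
      = (Matrix.diagonal fun i => (d i : ℂ)).submatrix e.symm e.symm from
        (Matrix.submatrix_diagonal_equiv (fun i => (d i : ℂ)) e.symm).symm,
      Matrix.submatrix_mul_equiv, Matrix.submatrix_mul_equiv]
  rw [h, mpow_conjDiag, mpow_conjDiag hU hU', h]
  · rfl
  · simp [Matrix.submatrix_mul_equiv, hU]
  · simp [Matrix.submatrix_mul_equiv, hU']

lemma trace_mpow_eq_sum_roots {ρ : Matrix n n ℂ} (hρ : ρ.IsHermitian) (p : ℝ) :
    (mpow ρ p).trace = (ρ.charpoly.roots.map fun z => ((z.re ^ p : ℝ) : ℂ)).sum := by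
  rw [hρ.roots_charpoly_eq_eigenvalues, mpow_eq_conjDiag hρ, conjDiag, Matrix.mul_assoc,
    Matrix.trace_mul_comm, Matrix.mul_assoc]
  have h : (hρ.eigenvectorUnitary : Matrix n n ℂ)ᴴ * (hρ.eigenvectorUnitary : Matrix n n ℂ) = 1 :=
    Unitary.coe_star_mul_self hρ.eigenvectorUnitary
  rw [h]
  simp [Matrix.trace]

lemma trace_mpow_mul_conjTranspose (M : Matrix n n ℂ) (p : ℝ) :
    (mpow (M * Mᴴ) p).trace = (mpow (Mᴴ * M) p).trace := by
  rw [trace_mpow_eq_sum_roots (Matrix.isHermitian_mul_conjTranspose_self M),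
    trace_mpow_eq_sum_roots (Matrix.isHermitian_conjTranspose_mul_self M),
    Matrix.charpoly_mul_comm]

/-- The orthogonal projection onto the support of a positive semidefinite matrix. -/
def suppProj (ρ : Matrix n n ℂ) : Matrix n n ℂ := mpow ρ (-1) * mpow ρ 1

lemma mpow_mul_mpow_neg {ρ : Matrix n n ℂ} (hρ : ρ.PosSemidef) {p q : ℝ} (hp : p ≠ 0)
    (h : p + q = 0) : mpow ρ p * mpow ρ q = suppProj ρ := by
  obtain rfl : q = -p := by linarith
  obtain ⟨U, d, hU, hU', hd, rfl⟩ := exists_conjDiag hρ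
  simp only [suppProj, mpow_conjDiag hU hU', conjDiag_mul hU']
  congr 1
  ext i
  rcases (hd i).eq_or_lt with h0 | h0
  · simp [← h0, Real.zero_rpow hp]
  · rw [← Real.rpow_add h0, ← Real.rpow_add h0]
    simp

lemma suppProj_mul_mpow {ρ : Matrix n n ℂ} (hρ : ρ.PosSemidef) {p : ℝ} (hp : p ≠ 0) :
    suppProj ρ * mpow ρ p = mpow ρ p := by
  obtain ⟨U, d, hU, hU', hd, rfl⟩ := exists_conjDiag hρ
  simp only [suppProj, mpow_conjDiag hU hU', conjDiag_mul hU']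
  congr 1
  ext i
  rcases (hd i).eq_or_lt with h0 | h0
  · simp [← h0, Real.zero_rpow hp]
  · rw [← Real.rpow_add h0, ← Real.rpow_add h0]
    simp

lemma suppProj_isHermitian {ρ : Matrix n n ℂ} (hρ : ρ.PosSemidef) :
    (suppProj ρ).IsHermitian := by
  obtain ⟨U, d, hU, hU', hd, rfl⟩ := exists_conjDiag hρ
  simp only [suppProj, mpow_conjDiag hU hU', conjDiag_mul hU']
  exact conjDiag_isHermitian _ _

lemma mpow_mul_suppProj {ρ : Matrix n n ℂ} (hρ : ρ.PosSemidef) {p : ℝ} (hp : p ≠ 0) :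
    mpow ρ p * suppProj ρ = mpow ρ p := by
  have h := congrArg Matrix.conjTranspose (suppProj_mul_mpow hρ hp)
  rwa [Matrix.conjTranspose_mul, (mpow_posSemidef hρ p).1, suppProj_isHermitian hρ] at h

lemma suppProj_mul_self {ρ : Matrix n n ℂ} (hρ : ρ.PosSemidef) :
    suppProj ρ * suppProj ρ = suppProj ρ := by
  conv_lhs => rw [suppProj, Matrix.mul_assoc, ← suppProj, mpow_mul_suppProj hρ one_ne_zero]
  rfl

lemma suppProj_mpow {ρ : Matrix n n ℂ} (hρ : ρ.PosSemidef) {p : ℝ} (hp : p ≠ 0) :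
    suppProj (mpow ρ p) = suppProj ρ := by
  rw [suppProj, mpow_mpow hρ, mpow_mpow hρ]
  exact mpow_mul_mpow_neg hρ (by simpa using hp) (by ring)

lemma suppProj_smul {ρ : Matrix n n ℂ} (hρ : ρ.PosSemidef) {c : ℝ} (hc : 0 < c) :
    suppProj ((c : ℂ) • ρ) = suppProj ρ := by
  rw [suppProj, mpow_smul hρ hc.le, mpow_smul hρ hc.le, Matrix.smul_mul, Matrix.mul_smul, smul_smul,
    ← Complex.ofReal_mul, ← Real.rpow_add hc]
  simp [suppProj]

lemma suppProj_kronecker {ρ : Matrix m m ℂ} {σ : Matrix n n ℂ} (hρ : ρ.PosSemidef)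
    (hσ : σ.PosSemidef) : suppProj (ρ ⊗ₖ σ) = suppProj ρ ⊗ₖ suppProj σ := by
  simp only [suppProj, mpow_kronecker hρ hσ, Matrix.mul_kronecker_mul]

lemma suppSubset_iff {ρ σ : Matrix n n ℂ} (hσ : σ.PosSemidef) :
    suppSubset ρ σ ↔ ρ * suppProj σ = ρ := by
  constructor
  · intro h
    refine Matrix.ext_of_mulVec_single fun i => ?_
    set v : n → ℂ := Pi.single i 1
    have h1 : σ * suppProj σ = σ := by
      simpa only [mpow_one hσ] using mpow_mul_suppProj hσ one_ne_zero
    have h2 := h (suppProj σ *ᵥ v - v) (by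
      rw [Matrix.mulVec_sub, Matrix.mulVec_mulVec, h1, sub_self])
    rwa [Matrix.mulVec_sub, Matrix.mulVec_mulVec, sub_eq_zero] at h2
  · intro h v hv
    rw [← h, suppProj, mpow_one hσ, ← Matrix.mulVec_mulVec, ← Matrix.mulVec_mulVec, hv]
    simp

lemma eq_zero_of_posSemidef_conj_eq_zero {ρ M : Matrix n n ℂ} (hρ : ρ.PosSemidef)
    (h : Mᴴ * ρ * M = 0) : mpow ρ (1 / 2) * M = 0 := by
  rw [← Matrix.conjTranspose_mul_self_eq_zero, Matrix.conjTranspose_mul,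
    (mpow_posSemidef hρ _).1, ← h, ← Matrix.mul_assoc, Matrix.mul_assoc Mᴴ,
    mpow_mul_mpow hρ (r := 1) (by norm_num) one_ne_zero, mpow_one hρ]

lemma mul_eq_zero_of_posSemidef_conj_eq_zero {ρ M : Matrix n n ℂ} (hρ : ρ.PosSemidef)
    (h : Mᴴ * ρ * M = 0) : ρ * M = 0 := by
  have h1 := eq_zero_of_posSemidef_conj_eq_zero hρ h
  nth_rw 1 [← mpow_one hρ]
  rw [← mpow_mul_mpow hρ (p := 1 / 2) (q := 1 / 2) (by norm_num) one_ne_zero, Matrix.mul_assoc, h1,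
    Matrix.mul_zero]

end SpectralPowers

section Divergence

variable {m n : Type*} [Fintype m] [DecidableEq m] [Fintype n] [DecidableEq n]

lemma D_ne_bot (α : ℝ) (ρ σ : Matrix n n ℂ) : D α ρ σ ≠ ⊥ := by
  unfold D
  split_ifs <;> simp

lemma D_eq_DR_of_ne_top {α : ℝ} {ρ σ : Matrix n n ℂ} (h : D α ρ σ ≠ ⊤) :
    D α ρ σ = (DR α ρ σ : ℝ) := by
  unfold D at h ⊢
  split_ifs at h ⊢
  · rfl
  · exact absurd rfl h

lemma D_eq_DR_of_suppSubset {α : ℝ} {ρ σ : Matrix n n ℂ} (h : suppSubset ρ σ) :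
    D α ρ σ = (DR α ρ σ : ℝ) := if_pos (Or.inr h)

lemma suppSubset_of_D_ne_top {α : ℝ} (hα : 1 < α) {ρ σ : Matrix n n ℂ} (h : D α ρ σ ≠ ⊤) :
    suppSubset ρ σ := by
  unfold D at h
  split_ifs at h with h1
  · exact h1.resolve_left fun h2 => hα.not_gt h2.1
  · exact absurd rfl h

lemma sandwich_posSemidef {ρ σ : Matrix n n ℂ} (hρ : ρ.PosSemidef) (hσ : σ.PosSemidef) (s : ℝ) :
    (mpow σ s * ρ * mpow σ s).PosSemidef := by
  have h := hρ.mul_mul_conjTranspose_same (mpow σ s)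
  rwa [(mpow_posSemidef hσ s).1] at h

/-- The sandwiched trace functional vanishes only for orthogonal operators. -/
lemma sandwich_trace_ne_zero {α : ℝ} {ρ σ : Matrix n n ℂ}
    (hρ : ρ.PosSemidef) (hσ : σ.PosSemidef) (hρ0 : ρ ≠ 0) (h : D α ρ σ ≠ ⊤) :
    (mpow (mpow σ ((1 - α) / (2 * α)) * ρ * mpow σ ((1 - α) / (2 * α))) α).trace ≠ 0 := by
  set s := (1 - α) / (2 * α) with hs
  intro h0
  have hP := sandwich_posSemidef hρ hσ s
  have h1 := (mpow_posSemidef hP α).trace_eq_zero_iff.1 h0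
  have h2 : mpow σ s * ρ * mpow σ s = 0 := by
    rw [← mpow_one hP, ← mpow_mul_mpow hP (p := α) (q := 1 - α) (by ring) one_ne_zero, h1,
      Matrix.zero_mul]
  have h3 : ρ * mpow σ s = 0 := mul_eq_zero_of_posSemidef_conj_eq_zero hρ (by
    rwa [(mpow_posSemidef hσ s).1])
  have h4 : ρ * σ = 0 := by
    rw [← mpow_one hσ, ← mpow_mul_mpow hσ (p := s) (q := 1 - s) (by ring) one_ne_zero,
      ← Matrix.mul_assoc, h3, Matrix.zero_mul]
  have h5 : σ * ρ = 0 := by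
    have := congrArg Matrix.conjTranspose h4
    rwa [Matrix.conjTranspose_mul, hρ.1, hσ.1, Matrix.conjTranspose_zero] at this
  have h6 : suppSubset ρ σ := by
    unfold D at h
    split_ifs at h with h1
    · exact h1.resolve_left fun h2 => h2.2 ⟨h4, h5⟩
    · exact absurd rfl h
  rw [suppSubset_iff hσ, ← mpow_mul_mpow_neg hσ (p := 1) (q := -1) one_ne_zero (by ring),
    mpow_one hσ, ← Matrix.mul_assoc, h4, Matrix.zero_mul] at h6
  exact hρ0 h6.symm

lemma D_eq_DR_of_sandwich_trace_ne_zero {α : ℝ} (hα0 : 0 < α) (hα1 : α < 1) {ρ σ : Matrix n n ℂ}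
    (hσ : σ.PosSemidef)
    (h : (mpow (mpow σ ((1 - α) / (2 * α)) * ρ * mpow σ ((1 - α) / (2 * α))) α).trace ≠ 0) :
    D α ρ σ = (DR α ρ σ : ℝ) := by
  refine if_pos (Or.inl ⟨hα1, fun h0 => h ?_⟩)
  have hs : (1 - α) / (2 * α) ≠ 0 := by
    have : 0 < 1 - α := by linarith
    positivity
  have h1 : ρ * mpow σ ((1 - α) / (2 * α)) = 0 := by
    rw [← mpow_mul_mpow hσ (p := 1) (q := (1 - α) / (2 * α) - 1) (by ring) hs, mpow_one hσ,
      ← Matrix.mul_assoc, h0.1, Matrix.zero_mul]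
  rw [Matrix.mul_assoc, h1, Matrix.mul_zero, mpow_zero_matrix hα0.ne', Matrix.trace_zero]

lemma trace_reindex (e : m ≃ n) (M : Matrix m m ℂ) : (Matrix.reindex e e M).trace = M.trace := by
  simp only [Matrix.trace, Matrix.diag, Matrix.reindex_apply, Matrix.submatrix_apply]
  exact e.symm.sum_comp fun i => M i i

lemma reindex_mul (e : m ≃ n) (M N : Matrix m m ℂ) :
    Matrix.reindex e e M * Matrix.reindex e e N = Matrix.reindex e e (M * N) := by
  simp only [Matrix.reindex_apply, Matrix.submatrix_mul_equiv]

lemma D_reindex {ρ σ : Matrix m m ℂ} (hρ : ρ.PosSemidef) (hσ : σ.PosSemidef) (e : m ≃ n)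
    (α : ℝ) : D α (Matrix.reindex e e ρ) (Matrix.reindex e e σ) = D α ρ σ := by
  have h0 : ∀ M : Matrix m m ℂ, Matrix.reindex e e M = 0 ↔ M = 0 := fun M =>
    ⟨fun h => (Matrix.reindex e e).injective (by simpa using h), fun h => by simp [h]⟩
  have h1 : suppSubset (Matrix.reindex e e ρ) (Matrix.reindex e e σ) ↔ suppSubset ρ σ := by
    have hσ' : (Matrix.reindex e e σ).PosSemidef := hσ.submatrix e.symm
    rw [suppSubset_iff hσ, suppSubset_iff hσ', suppProj, mpow_reindex hσ, mpow_reindex hσ,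
      reindex_mul, reindex_mul, (Matrix.reindex e e).injective.eq_iff, suppProj]
  have h2 : DR α (Matrix.reindex e e ρ) (Matrix.reindex e e σ) = DR α ρ σ := by
    simp only [DR, mpow_reindex hσ, reindex_mul, mpow_reindex (sandwich_posSemidef hρ hσ _),
      trace_reindex]
  unfold D
  rw [h2]
  classical exact if_congr (by rw [h1, reindex_mul, reindex_mul, h0, h0]) rfl rfl

end Divergence

section PartialTrace

variable {n B R : Type*} [Fintype n] [DecidableEq n] [Fintype B] [DecidableEq B]

lemma ptB_posSemidef {ρ : Matrix (n × B) (n × B) ℂ} (hρ : ρ.PosSemidef) :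
    (ptB ρ).PosSemidef := by
  have h : ptB ρ = ∑ b : B, ρ.submatrix (fun a => (a, b)) (fun a => (a, b)) := by
    ext a a'
    simp [ptB, Matrix.sum_apply]
  rw [h]
  exact Matrix.posSemidef_sum _ fun b _ => hρ.submatrix _

lemma trace_ptB (ρ : Matrix (n × B) (n × B) ℂ) : (ptB ρ).trace = ρ.trace := by
  simp [ptB, Matrix.trace, Fintype.sum_prod_type]

lemma kronecker_one_mul_apply (X : Matrix n n ℂ) (ρ : Matrix (n × B) (n × B) ℂ) (p q : n × B) :
    ((X ⊗ₖ (1 : Matrix B B ℂ)) * ρ) p q = ∑ a, X p.1 a * ρ (a, p.2) q := by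
  simp [Matrix.mul_apply, Fintype.sum_prod_type, Matrix.one_apply]

lemma mul_kronecker_one_apply (Y : Matrix n n ℂ) (ρ : Matrix (n × B) (n × B) ℂ) (p q : n × B) :
    (ρ * (Y ⊗ₖ (1 : Matrix B B ℂ))) p q = ∑ a, ρ p (a, q.2) * Y a q.1 := by
  simp [Matrix.mul_apply, Fintype.sum_prod_type, Matrix.one_apply]

lemma ptB_kronecker_one_mul (X : Matrix n n ℂ) (ρ : Matrix (n × B) (n × B) ℂ) :
    ptB ((X ⊗ₖ (1 : Matrix B B ℂ)) * ρ) = X * ptB ρ := by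
  ext a a'
  simp only [ptB, Matrix.of_apply, kronecker_one_mul_apply, Matrix.mul_apply (M := X),
    Finset.mul_sum]
  exact Finset.sum_comm

lemma ptB_mul_kronecker_one (Y : Matrix n n ℂ) (ρ : Matrix (n × B) (n × B) ℂ) :
    ptB (ρ * (Y ⊗ₖ (1 : Matrix B B ℂ))) = ptB ρ * Y := by
  ext a a'
  simp only [ptB, Matrix.of_apply, mul_kronecker_one_apply, Matrix.mul_apply (N := Y),
    Finset.sum_mul]
  exact Finset.sum_comm

lemma kronecker_one_isHermitian {T : Matrix n n ℂ} (hT : T.IsHermitian) :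
    (T ⊗ₖ (1 : Matrix B B ℂ))ᴴ = T ⊗ₖ (1 : Matrix B B ℂ) := by
  rw [Matrix.conjTranspose_kronecker, hT, Matrix.conjTranspose_one]

lemma one_kronecker_isHermitian {T : Matrix B B ℂ} (hT : T.IsHermitian) :
    ((1 : Matrix n n ℂ) ⊗ₖ T)ᴴ = (1 : Matrix n n ℂ) ⊗ₖ T := by
  rw [Matrix.conjTranspose_kronecker, hT, Matrix.conjTranspose_one]

lemma mul_kronecker_one_eq_zero {ρ : Matrix (n × B) (n × B) ℂ} (hρ : ρ.PosSemidef)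
    {T : Matrix n n ℂ} (hT : T.IsHermitian) (h : ptB ρ * T = 0) :
    ρ * (T ⊗ₖ (1 : Matrix B B ℂ)) = 0 := by
  have hT' := kronecker_one_isHermitian (B := B) hT
  apply mul_eq_zero_of_posSemidef_conj_eq_zero hρ
  have hP := hρ.conjTranspose_mul_mul_same (T ⊗ₖ (1 : Matrix B B ℂ))
  apply hP.trace_eq_zero_iff.1
  rw [hT', ← trace_ptB, ptB_mul_kronecker_one, ptB_kronecker_one_mul, Matrix.mul_assoc, h]
  simp

lemma mul_kronecker_one_eq_self {ρ : Matrix (n × B) (n × B) ℂ} (hρ : ρ.PosSemidef)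
    {T : Matrix n n ℂ} (hT : T.IsHermitian) (h : ptB ρ * T = ptB ρ) :
    ρ * (T ⊗ₖ (1 : Matrix B B ℂ)) = ρ := by
  have h1 := mul_kronecker_one_eq_zero hρ (T := T - 1) (hT.sub Matrix.isHermitian_one)
    (by rw [Matrix.mul_sub, h, Matrix.mul_one, sub_self])
  have h2 : (T - 1) ⊗ₖ (1 : Matrix B B ℂ) = T ⊗ₖ (1 : Matrix B B ℂ) - 1 := by
    rw [eq_sub_iff_add_eq, ← Matrix.one_kronecker_one, ← Matrix.add_kronecker, sub_add_cancel]
  rw [h2, Matrix.mul_sub, Matrix.mul_one, sub_eq_zero] at h1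
  exact h1

lemma mul_suppProj_ptB {ρ : Matrix (n × B) (n × B) ℂ} (hρ : ρ.PosSemidef) :
    ρ * (suppProj (ptB ρ) ⊗ₖ (1 : Matrix B B ℂ)) = ρ := by
  have h := ptB_posSemidef hρ
  apply mul_kronecker_one_eq_self hρ (suppProj_isHermitian h)
  simpa only [mpow_one h] using mpow_mul_suppProj h one_ne_zero

lemma suppProj_ptB_mul {ρ : Matrix (n × B) (n × B) ℂ} (hρ : ρ.PosSemidef) :
    (suppProj (ptB ρ) ⊗ₖ (1 : Matrix B B ℂ)) * ρ = ρ := by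
  have h := congrArg Matrix.conjTranspose (mul_suppProj_ptB hρ)
  rwa [Matrix.conjTranspose_mul, hρ.1,
    kronecker_one_isHermitian (suppProj_isHermitian (ptB_posSemidef hρ))] at h

/-- The conditional operator of `ρ` (with marginal `r`) applied to the marginal `ν`. -/
def replaceMarginal (r ν : Matrix n n ℂ) (ρ : Matrix (n × B) (n × B) ℂ) :
    Matrix (n × B) (n × B) ℂ :=
  ((mpow ν (1 / 2 : ℝ)) ⊗ₖ (1 : Matrix B B ℂ)) *
    (((mpow r (-(1 / 2) : ℝ)) ⊗ₖ (1 : Matrix B B ℂ)) * ρ *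
      ((mpow r (-(1 / 2) : ℝ)) ⊗ₖ (1 : Matrix B B ℂ))) *
    ((mpow ν (1 / 2 : ℝ)) ⊗ₖ (1 : Matrix B B ℂ))

lemma replaceMarginal_eq {r ν : Matrix n n ℂ} (hr : r.PosSemidef) (hν : ν.PosSemidef)
    (ρ : Matrix (n × B) (n × B) ℂ) :
    replaceMarginal r ν ρ = ((mpow ν (1 / 2) * mpow r (-(1 / 2))) ⊗ₖ (1 : Matrix B B ℂ)) * ρ *
      ((mpow ν (1 / 2) * mpow r (-(1 / 2))) ⊗ₖ (1 : Matrix B B ℂ))ᴴ := by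
  rw [Matrix.conjTranspose_kronecker, Matrix.conjTranspose_mul, (mpow_posSemidef hr _).1,
    (mpow_posSemidef hν _).1, Matrix.conjTranspose_one]
  nth_rw 1 [← Matrix.one_mul (1 : Matrix B B ℂ)]
  nth_rw 3 [← Matrix.one_mul (1 : Matrix B B ℂ)]
  rw [Matrix.mul_kronecker_mul, Matrix.mul_kronecker_mul]
  simp only [replaceMarginal, Matrix.mul_assoc]

lemma replaceMarginal_posSemidef {r ν : Matrix n n ℂ} (hr : r.PosSemidef) (hν : ν.PosSemidef)
    {ρ : Matrix (n × B) (n × B) ℂ} (hρ : ρ.PosSemidef) : (replaceMarginal r ν ρ).PosSemidef := by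
  rw [replaceMarginal_eq hr hν]
  exact hρ.mul_mul_conjTranspose_same _

lemma ptB_replaceMarginal {r ν : Matrix n n ℂ} (hr : r.PosSemidef) (hν : ν.PosSemidef)
    {ρ : Matrix (n × B) (n × B) ℂ} (hρ : ptB ρ = r) (h : ν * suppProj r = ν) :
    ptB (replaceMarginal r ν ρ) = ν := by
  have h1 : mpow ν (1 / 2) * suppProj r = mpow ν (1 / 2) := by
    nth_rw 1 [← mpow_mul_mpow hν (p := -(1 / 2)) (q := 1) (by norm_num) (by norm_num)]
    rw [mpow_one hν, Matrix.mul_assoc, h]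
    nth_rw 2 [← mpow_one hν]
    rw [mpow_mul_mpow hν (r := 1 / 2) (by norm_num) (by norm_num)]
  have h2 : mpow r (-(1 / 2)) * r = mpow r (1 / 2) := by
    nth_rw 2 [← mpow_one hr]
    rw [mpow_mul_mpow hr (r := 1 / 2) (by norm_num) (by norm_num)]
  rw [replaceMarginal, ptB_mul_kronecker_one, ptB_kronecker_one_mul, ptB_mul_kronecker_one,
    ptB_kronecker_one_mul, hρ, h2,
    mpow_mul_mpow_neg hr (by norm_num) (by norm_num), h1,
    mpow_mul_mpow hν (r := 1) (by norm_num) (by norm_num), mpow_one hν]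

section Channel

variable [Fintype R] [DecidableEq R]

lemma lext_kronecker_one_mul (N : Matrix R R ℂ →ₗ[ℂ] Matrix B B ℂ) (X : Matrix n n ℂ)
    (ρ : Matrix (n × R) (n × R) ℂ) :
    lext N ((X ⊗ₖ (1 : Matrix R R ℂ)) * ρ) = (X ⊗ₖ (1 : Matrix B B ℂ)) * lext N ρ := by
  ext p q
  rw [kronecker_one_mul_apply]
  simp only [lext, LinearMap.coe_mk, AddHom.coe_mk, Matrix.of_apply, kronecker_one_mul_apply]
  have h : (Matrix.of fun a a' => ∑ c, X p.1 c * ρ (c, a) (q.1, a'))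
      = ∑ c, X p.1 c • Matrix.of fun a a' => ρ (c, a) (q.1, a') := by
    ext a a'
    simp [Matrix.sum_apply]
  rw [h, map_sum, Matrix.sum_apply]
  exact Finset.sum_congr rfl fun c _ => by rw [LinearMap.map_smul, Matrix.smul_apply, smul_eq_mul]

lemma lext_mul_kronecker_one (N : Matrix R R ℂ →ₗ[ℂ] Matrix B B ℂ) (Y : Matrix n n ℂ)
    (ρ : Matrix (n × R) (n × R) ℂ) :
    lext N (ρ * (Y ⊗ₖ (1 : Matrix R R ℂ))) = lext N ρ * (Y ⊗ₖ (1 : Matrix B B ℂ)) := by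
  ext p q
  rw [mul_kronecker_one_apply]
  simp only [lext, LinearMap.coe_mk, AddHom.coe_mk, Matrix.of_apply, mul_kronecker_one_apply]
  have h : (Matrix.of fun a a' => ∑ c, ρ (p.1, a) (c, a') * Y c q.1)
      = ∑ c, Y c q.1 • Matrix.of fun a a' => ρ (p.1, a) (c, a') := by
    ext a a'
    simp [Matrix.sum_apply, mul_comm]
  rw [h, map_sum, Matrix.sum_apply]
  exact Finset.sum_congr rfl fun c _ => by
    rw [LinearMap.map_smul, Matrix.smul_apply, smul_eq_mul, mul_comm]

lemma lext_replaceMarginal (N : Matrix R R ℂ →ₗ[ℂ] Matrix B B ℂ) (r ν : Matrix n n ℂ)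
    (ρ : Matrix (n × R) (n × R) ℂ) :
    lext N (replaceMarginal r ν ρ) = replaceMarginal r ν (lext N ρ) := by
  simp only [replaceMarginal, lext_mul_kronecker_one, lext_kronecker_one_mul]

lemma ptB_lext {N : Matrix R R ℂ →ₗ[ℂ] Matrix B B ℂ} (hN : ∀ M, (N M).trace = M.trace)
    (ρ : Matrix (n × R) (n × R) ℂ) : ptB (lext N ρ) = ptB ρ := by
  ext a a'
  exact hN (Matrix.of fun x x' => ρ (a, x) (a', x'))

end Channel

end PartialTrace

section Chain

variable {n B : Type*} [Fintype n] [DecidableEq n] [Fintype B] [DecidableEq B]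

/-- The operator `r^{1/2} w^{(1-α)/α} r^{1/2}`. -/
def innerSandwich (α : ℝ) (r w : Matrix n n ℂ) : Matrix n n ℂ :=
  mpow r (1 / 2 : ℝ) * mpow w ((1 - α) / α) * mpow r (1 / 2 : ℝ)

/-- The normalized operator `(r^{1/2} w^{(1-α)/α} r^{1/2})^α`. -/
def tiltedState (α : ℝ) (r w : Matrix n n ℂ) : Matrix n n ℂ :=
  ((mpow (innerSandwich α r w) α).trace)⁻¹ • mpow (innerSandwich α r w) α

lemma innerSandwich_posSemidef {r w : Matrix n n ℂ} (hr : r.PosSemidef) (hw : w.PosSemidef)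
    (α : ℝ) : (innerSandwich α r w).PosSemidef :=
  sandwich_posSemidef (mpow_posSemidef hw _) hr _

lemma half_mul_half {r : Matrix n n ℂ} (hr : r.PosSemidef) :
    mpow r (1 / 2) * mpow r (1 / 2) = r := by
  rw [mpow_mul_mpow hr (r := 1) (by norm_num) one_ne_zero, mpow_one hr]

lemma exponent_mul_self {α : ℝ} (hα0 : 0 < α) (hα1 : α ≠ 1) {w : Matrix n n ℂ}
    (hw : w.PosSemidef) :
    mpow w ((1 - α) / (2 * α)) * mpow w ((1 - α) / (2 * α)) = mpow w ((1 - α) / α) :=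
  mpow_mul_mpow hw (by field_simp; ring) (div_ne_zero (sub_ne_zero.2 hα1.symm) hα0.ne')

lemma trace_sandwich_eq {α : ℝ} (hα0 : 0 < α) (hα1 : α ≠ 1) {r w : Matrix n n ℂ}
    (hr : r.PosSemidef) (hw : w.PosSemidef) :
    (mpow (mpow w ((1 - α) / (2 * α)) * r * mpow w ((1 - α) / (2 * α))) α).trace
      = (mpow (innerSandwich α r w) α).trace := by
  have h := trace_mpow_mul_conjTranspose (mpow w ((1 - α) / (2 * α)) * mpow r (1 / 2)) α
  rw [Matrix.conjTranspose_mul, (mpow_posSemidef hw _).1, (mpow_posSemidef hr _).1] at h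
  convert h using 3
  · conv_lhs => rw [← half_mul_half hr]
    simp only [Matrix.mul_assoc]
  · rw [innerSandwich, ← exponent_mul_self hα0 hα1 hw]
    simp only [Matrix.mul_assoc]

lemma mul_suppProj_innerSandwich {α : ℝ} (hα0 : 0 < α) (hα1 : α ≠ 1) {r w : Matrix n n ℂ}
    (hr : r.PosSemidef) (hw : w.PosSemidef) (h : suppSubset r w) :
    r * suppProj (innerSandwich α r w) = r := by
  set X := innerSandwich α r w with hX
  have hXp : X.PosSemidef := innerSandwich_posSemidef hr hw α
  have hq : (1 - α) / α ≠ 0 := div_ne_zero (sub_ne_zero.2 hα1.symm) hα0.ne'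
  set M := suppProj X - 1 with hM
  have hXM : X * M = 0 := by
    have := mpow_mul_suppProj hXp one_ne_zero
    rw [mpow_one hXp] at this
    rw [hM, Matrix.mul_sub, this, Matrix.mul_one, sub_self]
  have h1 : (mpow r (1 / 2) * M)ᴴ * mpow w ((1 - α) / α) * (mpow r (1 / 2) * M) = 0 := by
    rw [Matrix.conjTranspose_mul, (mpow_posSemidef hr _).1]
    calc _ = Mᴴ * (X * M) := by simp only [hX, innerSandwich, Matrix.mul_assoc]
      _ = 0 := by rw [hXM, Matrix.mul_zero]
  have h2 := mul_eq_zero_of_posSemidef_conj_eq_zero (mpow_posSemidef hw _) h1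
  have h3 : suppProj w * mpow r (1 / 2) = mpow r (1 / 2) := by
    rw [suppSubset_iff hw] at h
    have h4 : suppProj w * r = r := by
      have := congrArg Matrix.conjTranspose h
      rwa [Matrix.conjTranspose_mul, hr.1, suppProj_isHermitian hw] at this
    rw [← mpow_mul_mpow hr (p := 1) (q := -(1 / 2)) (by norm_num) (by norm_num), mpow_one hr,
      ← Matrix.mul_assoc, h4]
  have h5 : mpow r (1 / 2) * M = 0 := by
    rw [← h3, ← mpow_mul_mpow_neg hw (p := -((1 - α) / α)) (q := (1 - α) / α)
      (neg_ne_zero.2 hq) (by ring), Matrix.mul_assoc, Matrix.mul_assoc, h2, Matrix.mul_zero]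
  have h6 : r * M = 0 := by
    conv_lhs => rw [← half_mul_half hr]
    rw [Matrix.mul_assoc, h5, Matrix.mul_zero]
  rwa [hM, Matrix.mul_sub, Matrix.mul_one, sub_eq_zero] at h6

lemma suppProj_innerSandwich_mul {r w : Matrix n n ℂ} (hr : r.PosSemidef) (hw : w.PosSemidef)
    (α : ℝ) : suppProj (innerSandwich α r w) * suppProj r = suppProj (innerSandwich α r w) := by
  have hXp := innerSandwich_posSemidef hr hw α
  conv_lhs => rw [suppProj, mpow_one hXp, Matrix.mul_assoc]
  have h : innerSandwich α r w * suppProj r = innerSandwich α r w := by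
    conv_lhs => rw [innerSandwich, Matrix.mul_assoc, mpow_mul_suppProj hr (by norm_num)]
    rfl
  rw [h, suppProj, mpow_one hXp]

section Tilted

variable {α : ℝ} {r w : Matrix n n ℂ} {t : ℝ}

lemma tiltedState_eq (htr : (mpow (innerSandwich α r w) α).trace = (t : ℂ)) :
    tiltedState α r w = ((t⁻¹ : ℝ) : ℂ) • mpow (innerSandwich α r w) α := by
  rw [tiltedState, htr, Complex.ofReal_inv]

lemma tiltedState_posSemidef (hr : r.PosSemidef) (hw : w.PosSemidef) :
    (tiltedState α r w).PosSemidef := by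
  have h := mpow_posSemidef (innerSandwich_posSemidef hr hw α) α
  exact h.smul (inv_nonneg.2 h.trace_nonneg)

lemma suppProj_tiltedState (hα0 : 0 < α) (hr : r.PosSemidef) (hw : w.PosSemidef) (ht : 0 < t)
    (htr : (mpow (innerSandwich α r w) α).trace = (t : ℂ)) :
    suppProj (tiltedState α r w) = suppProj (innerSandwich α r w) := by
  have hX := innerSandwich_posSemidef hr hw α
  rw [tiltedState_eq htr, suppProj_smul (mpow_posSemidef hX _) (inv_pos.2 ht),
    suppProj_mpow hX hα0.ne']

lemma tiltedState_mul_suppProj (hα0 : 0 < α) (hr : r.PosSemidef) (hw : w.PosSemidef) (ht : 0 < t)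
    (htr : (mpow (innerSandwich α r w) α).trace = (t : ℂ)) :
    tiltedState α r w * suppProj r = tiltedState α r w := by
  have hν := tiltedState_posSemidef (α := α) hr hw
  have h1 : tiltedState α r w * suppProj (tiltedState α r w) = tiltedState α r w := by
    simpa only [mpow_one hν] using mpow_mul_suppProj hν one_ne_zero
  conv_lhs => rw [← h1, suppProj_tiltedState hα0 hr hw ht htr, Matrix.mul_assoc,
    suppProj_innerSandwich_mul hr hw, ← suppProj_tiltedState hα0 hr hw ht htr, h1]

lemma mpow_tiltedState (hα0 : 0 < α) (hr : r.PosSemidef) (hw : w.PosSemidef) (ht : 0 < t)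
    (htr : (mpow (innerSandwich α r w) α).trace = (t : ℂ)) :
    mpow (tiltedState α r w) ((1 - α) / (2 * α)) * mpow (tiltedState α r w) (1 / 2)
      = ((t⁻¹ ^ (1 / (2 * α)) : ℝ) : ℂ) • mpow (innerSandwich α r w) (1 / 2) := by
  have hX := innerSandwich_posSemidef hr hw α
  rw [mpow_mul_mpow (tiltedState_posSemidef hr hw) (r := 1 / (2 * α)) (by field_simp; ring)
    (by positivity), tiltedState_eq htr, mpow_smul (mpow_posSemidef hX _) (inv_pos.2 ht).le,
    mpow_mpow hX]
  congr 2
  field_simp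

end Tilted

/-- Multiplicativity of the sandwiched trace functional along the conditional operator. -/
lemma trace_sandwich_chain {α : ℝ} (hα0 : 0 < α) (hα1 : α ≠ 1)
    {ρ : Matrix (n × B) (n × B) ℂ} (hρ : ρ.PosSemidef) {w : Matrix n n ℂ} (hw : w.PosSemidef)
    {σ : Matrix B B ℂ} (hσ : σ.PosSemidef) {t : ℝ} (ht : 0 < t)
    (htr : (mpow (innerSandwich α (ptB ρ) w) α).trace = (t : ℂ)) :
    (mpow (mpow (w ⊗ₖ σ) ((1 - α) / (2 * α)) * ρ * mpow (w ⊗ₖ σ) ((1 - α) / (2 * α))) α).trace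
      = (t : ℂ) * (mpow (mpow (tiltedState α (ptB ρ) w ⊗ₖ σ) ((1 - α) / (2 * α)) *
          replaceMarginal (ptB ρ) (tiltedState α (ptB ρ) w) ρ *
          mpow (tiltedState α (ptB ρ) w ⊗ₖ σ) ((1 - α) / (2 * α))) α).trace := by
  set s := (1 - α) / (2 * α) with hs
  have hr := ptB_posSemidef hρ
  set r := ptB ρ with hr_def
  set X := innerSandwich α r w with hX_def
  have hX : X.PosSemidef := innerSandwich_posSemidef hr hw α
  set ν := tiltedState α r w with hν_def
  have hν : ν.PosSemidef := tiltedState_posSemidef hr hw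
  set K := mpow w s
  set S := mpow σ s
  have hK : Kᴴ = K := (mpow_posSemidef hw _).1
  have hS : Sᴴ = S := (mpow_posSemidef hσ _).1
  have hXh : (mpow X (1 / 2))ᴴ = mpow X (1 / 2) := (mpow_posSemidef hX _).1
  have hrh : (mpow r (1 / 2))ᴴ = mpow r (1 / 2) := (mpow_posSemidef hr _).1
  have hrh' : (mpow r (-(1 / 2)))ᴴ = mpow r (-(1 / 2)) := (mpow_posSemidef hr _).1
  have hνh : (mpow ν (1 / 2))ᴴ = mpow ν (1 / 2) := (mpow_posSemidef hν _).1
  have hρh : (mpow ρ (1 / 2))ᴴ = mpow ρ (1 / 2) := (mpow_posSemidef hρ _).1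
  set E := (mpow r (-(1 / 2)) ⊗ₖ (1 : Matrix B B ℂ)) * mpow ρ (1 / 2) with hE
  have hkk : ∀ (P P' : Matrix n n ℂ) (Q Q' : Matrix B B ℂ) (Z : Matrix (n × B) (n × B) ℂ),
      (P ⊗ₖ Q) * ((P' ⊗ₖ Q') * Z) = ((P * P') ⊗ₖ (Q * Q')) * Z := fun P P' Q Q' Z => by
    rw [← Matrix.mul_assoc, ← Matrix.mul_kronecker_mul]
  have hEE : E * Eᴴ = (mpow r (-(1 / 2)) ⊗ₖ (1 : Matrix B B ℂ)) * ρ *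
      (mpow r (-(1 / 2)) ⊗ₖ (1 : Matrix B B ℂ)) := by
    conv_rhs => rw [← half_mul_half hρ]
    simp only [hE, Matrix.conjTranspose_mul, Matrix.conjTranspose_kronecker, hρh, hrh',
      Matrix.conjTranspose_one, Matrix.mul_assoc]
  have hρE : ρ = (mpow r (1 / 2) ⊗ₖ (1 : Matrix B B ℂ)) * (E * Eᴴ) *
      (mpow r (1 / 2) ⊗ₖ (1 : Matrix B B ℂ)) := by
    rw [hEE]
    simp only [Matrix.mul_assoc, ← Matrix.mul_kronecker_mul, Matrix.mul_one]
    rw [hkk, mpow_mul_mpow_neg hr (by norm_num) (by norm_num),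
      mpow_mul_mpow_neg hr (by norm_num) (by norm_num), Matrix.mul_one, hr_def,
      mul_suppProj_ptB hρ, suppProj_ptB_mul hρ]
  set M := ((K * mpow r (1 / 2)) ⊗ₖ S) * E with hM
  set M' := (mpow X (1 / 2) ⊗ₖ S) * E with hM'
  have h1 : mpow (w ⊗ₖ σ) s * ρ * mpow (w ⊗ₖ σ) s = M * Mᴴ := by
    conv_lhs => rw [mpow_kronecker hw hσ, hρE]
    simp only [hM, Matrix.conjTranspose_mul, Matrix.conjTranspose_kronecker, hK, hS, hrh,
      Matrix.mul_assoc, hkk, ← Matrix.mul_kronecker_mul, Matrix.mul_one, Matrix.one_mul]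
    rfl
  have h2 : Mᴴ * M = M'ᴴ * M' := by
    simp only [hM, hM', Matrix.conjTranspose_mul, Matrix.conjTranspose_kronecker, hK, hS, hrh, hXh,
      Matrix.mul_assoc, hkk]
    have h3 : mpow r (1 / 2) * (K * (K * mpow r (1 / 2))) = mpow X (1 / 2) * mpow X (1 / 2) := by
      rw [half_mul_half hX, hX_def, innerSandwich, ← exponent_mul_self hα0 hα1 hw]
      simp only [Matrix.mul_assoc]
      rfl
    rw [h3]
  set c : ℝ := t⁻¹ ^ (1 / (2 * α)) with hc
  have hc0 : 0 ≤ c := Real.rpow_nonneg (inv_pos.2 ht).le _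
  have h4 : mpow (ν ⊗ₖ σ) s * replaceMarginal r ν ρ * mpow (ν ⊗ₖ σ) s
      = ((c * c : ℝ) : ℂ) • (M' * M'ᴴ) := by
    have h5 : mpow ν s * mpow ν (1 / 2) = (c : ℂ) • mpow X (1 / 2) :=
      mpow_tiltedState hα0 hr hw ht htr
    have h6 : mpow ν (1 / 2) * mpow ν s = (c : ℂ) • mpow X (1 / 2) := by
      have := congrArg Matrix.conjTranspose h5
      rw [Matrix.conjTranspose_mul, hνh, Matrix.conjTranspose_smul, hXh,
        (mpow_posSemidef hν _).1] at this
      simpa using this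
    calc _ = ((mpow ν s * mpow ν (1 / 2)) ⊗ₖ S) * (E * Eᴴ) *
          ((mpow ν (1 / 2) * mpow ν s) ⊗ₖ S) := by
          rw [hEE, mpow_kronecker hν hσ, replaceMarginal]
          simp only [Matrix.mul_assoc, hkk, ← Matrix.mul_kronecker_mul, Matrix.mul_one,
            Matrix.one_mul]
          rfl
      _ = _ := by
          rw [h5, h6]
          simp only [hM', Matrix.conjTranspose_mul, Matrix.conjTranspose_kronecker, hS, hXh,
            Matrix.smul_kronecker, Matrix.smul_mul, Matrix.mul_smul, smul_smul, Matrix.mul_assoc,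
            Complex.ofReal_mul]
  have h7 : (c * c) ^ α = t⁻¹ := by
    rw [hc, ← Real.rpow_add (inv_pos.2 ht), ← Real.rpow_mul (inv_pos.2 ht).le]
    convert Real.rpow_one _ using 2
    field_simp
    norm_num
  rw [h1, h4, mpow_smul (Matrix.posSemidef_self_mul_conjTranspose M') (mul_nonneg hc0 hc0), h7,
    Matrix.trace_smul, trace_mpow_mul_conjTranspose, trace_mpow_mul_conjTranspose, h2, smul_eq_mul,
    ← mul_assoc (t : ℂ), ← Complex.ofReal_mul, mul_inv_cancel₀ ht.ne', Complex.ofReal_one, one_mul]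

/-- Support inclusion lifts along the conditional operator. -/
lemma suppSubset_kronecker_of_replaceMarginal {ρ : Matrix (n × B) (n × B) ℂ} (hρ : ρ.PosSemidef)
    {w ν : Matrix n n ℂ} (hw : w.PosSemidef) (hν : ν.PosSemidef) {σ : Matrix B B ℂ}
    (hσ : σ.PosSemidef) (hrw : suppSubset (ptB ρ) w) (hrν : ptB ρ * suppProj ν = ptB ρ)
    (h : suppSubset (replaceMarginal (ptB ρ) ν ρ) (ν ⊗ₖ σ)) : suppSubset ρ (w ⊗ₖ σ) := by
  have hr := ptB_posSemidef hρ
  set r := ptB ρ with hr_def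
  have hS := suppProj_isHermitian hσ
  rw [suppSubset_iff (hν.kronecker hσ), suppProj_kronecker hν hσ] at h
  rw [suppSubset_iff hw] at hrw
  rw [suppSubset_iff (hw.kronecker hσ), suppProj_kronecker hw hσ]
  have hw1 : ρ * (suppProj w ⊗ₖ (1 : Matrix B B ℂ)) = ρ :=
    mul_kronecker_one_eq_self hρ (suppProj_isHermitian hw) hrw
  set N := replaceMarginal r ν ρ with hN
  have hN1 : N * ((1 : Matrix n n ℂ) ⊗ₖ suppProj σ) = N := by
    rw [← h, Matrix.mul_assoc, ← Matrix.mul_kronecker_mul, Matrix.mul_one, suppProj_mul_self hσ]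
  set T : Matrix (n × B) (n × B) ℂ := (1 : Matrix n n ℂ) ⊗ₖ suppProj σ - 1 with hT
  have hNT : N * T = 0 := by rw [hT, Matrix.mul_sub, hN1, Matrix.mul_one, sub_self]
  have hTH : Tᴴ = T := by
    rw [hT, Matrix.conjTranspose_sub, one_kronecker_isHermitian hS, Matrix.conjTranspose_one]
  have hcomm : ∀ Y : Matrix n n ℂ, T * (Y ⊗ₖ (1 : Matrix B B ℂ))
      = (Y ⊗ₖ (1 : Matrix B B ℂ)) * T := fun Y => by
    simp only [hT, Matrix.sub_mul, Matrix.mul_sub, ← Matrix.mul_kronecker_mul, Matrix.one_mul,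
      Matrix.mul_one]
  set G := mpow ν (1 / 2) * mpow r (-(1 / 2)) with hG
  have hGH : (G ⊗ₖ (1 : Matrix B B ℂ))ᴴ = Gᴴ ⊗ₖ (1 : Matrix B B ℂ) := by
    rw [Matrix.conjTranspose_kronecker, Matrix.conjTranspose_one]
  have h1 : ρ * (T * (Gᴴ ⊗ₖ (1 : Matrix B B ℂ))) = 0 := by
    apply mul_eq_zero_of_posSemidef_conj_eq_zero hρ
    rw [Matrix.conjTranspose_mul, ← hGH, Matrix.conjTranspose_conjTranspose, hTH, ← hcomm, hGH,
      hcomm Gᴴ]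
    calc _ = T * (((G ⊗ₖ (1 : Matrix B B ℂ)) * ρ * (G ⊗ₖ (1 : Matrix B B ℂ))ᴴ) * T) := by
            rw [hGH]
            simp only [Matrix.mul_assoc]
      _ = 0 := by rw [← replaceMarginal_eq hr hν, ← hN, hNT, Matrix.mul_zero]
  have hrν' : suppProj ν * mpow r (1 / 2) = mpow r (1 / 2) := by
    have h4 : suppProj ν * r = r := by
      have := congrArg Matrix.conjTranspose hrν
      rwa [Matrix.conjTranspose_mul, hr.1, suppProj_isHermitian hν] at this
    rw [← mpow_mul_mpow hr (p := 1) (q := -(1 / 2)) (by norm_num) (by norm_num), mpow_one hr,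
      ← Matrix.mul_assoc, h4]
  have h2 : Gᴴ * (mpow ν (-(1 / 2)) * mpow r (1 / 2)) = suppProj r := by
    rw [hG, Matrix.conjTranspose_mul, (mpow_posSemidef hν _).1, (mpow_posSemidef hr _).1,
      Matrix.mul_assoc, ← Matrix.mul_assoc (mpow ν (1 / 2)),
      mpow_mul_mpow_neg hν (by norm_num) (by norm_num), hrν',
      mpow_mul_mpow_neg hr (by norm_num) (by norm_num)]
  have h3 : ρ * T = 0 := by
    have h4 := congrArg (fun Z => Z * ((mpow ν (-(1 / 2)) * mpow r (1 / 2)) ⊗ₖ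
      (1 : Matrix B B ℂ))) h1
    simp only [Matrix.zero_mul, Matrix.mul_assoc] at h4
    rwa [← Matrix.mul_kronecker_mul, h2, Matrix.one_mul, hcomm, ← Matrix.mul_assoc, hr_def,
      mul_suppProj_ptB hρ] at h4
  rw [hT, Matrix.mul_sub, Matrix.mul_one, sub_eq_zero] at h3
  nth_rw 1 [← hw1]
  rw [Matrix.mul_assoc, ← Matrix.mul_kronecker_mul, suppProj_mul_self hw, Matrix.one_mul]
  conv_rhs => rw [← h3]
  nth_rw 2 [← hw1]
  rw [Matrix.mul_assoc, ← Matrix.mul_kronecker_mul, Matrix.one_mul, Matrix.mul_one]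

lemma exists_trace_innerSandwich {α : ℝ} (hα0 : 0 < α) (hα1 : α ≠ 1) {r w : Matrix n n ℂ}
    (hr : IsState r) (hw : w.PosSemidef) (h : D α r w ≠ ⊤) :
    ∃ t : ℝ, 0 < t ∧ (mpow (innerSandwich α r w) α).trace = (t : ℂ) := by
  have h0 : (0 : ℂ) ≤ (mpow (innerSandwich α r w) α).trace :=
    (mpow_posSemidef (innerSandwich_posSemidef hr.1 hw α) α).trace_nonneg
  have hr0 : r ≠ 0 := by
    rintro rfl
    simpa using hr.2
  have h1 := sandwich_trace_ne_zero hr.1 hw hr0 h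
  rw [trace_sandwich_eq hα0 hα1 hr.1 hw] at h1
  have h2 := lt_of_le_of_ne h0 h1.symm
  rw [Complex.lt_def] at h2
  exact ⟨_, h2.1, Complex.ext (by simp) (by simpa using h2.2.symm)⟩

lemma D_kronecker_le {α : ℝ} (hα0 : 0 < α) (hα1 : α ≠ 1)
    {ρ : Matrix (n × B) (n × B) ℂ} (hρ : IsState ρ) {w : Matrix n n ℂ} (hw : w.PosSemidef)
    (hD : D α (ptB ρ) w ≠ ⊤) {σ : Matrix B B ℂ} (hσ : σ.PosSemidef) {ν : Matrix n n ℂ}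
    (hν_def : ν = tiltedState α (ptB ρ) w) :
    D α ρ (w ⊗ₖ σ) ≤ D α (replaceMarginal (ptB ρ) ν ρ) (ν ⊗ₖ σ) + D α (ptB ρ) w := by
  have hr : IsState (ptB ρ) := ⟨ptB_posSemidef hρ.1, (trace_ptB ρ).trans hρ.2⟩
  obtain ⟨t, ht, htr⟩ := exists_trace_innerSandwich hα0 hα1 hr hw hD
  have hν : ν.PosSemidef := hν_def ▸ tiltedState_posSemidef hr.1 hw
  have hN : (replaceMarginal (ptB ρ) ν ρ).PosSemidef := replaceMarginal_posSemidef hr.1 hν hρ.1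
  have hNν : ptB (replaceMarginal (ptB ρ) ν ρ) = ν :=
    ptB_replaceMarginal hr.1 hν rfl (hν_def ▸ tiltedState_mul_suppProj hα0 hr.1 hw ht htr)
  have hνtr : ν.trace = 1 := by
    rw [hν_def, tiltedState, Matrix.trace_smul, htr, smul_eq_mul,
      inv_mul_cancel₀ (by exact_mod_cast ht.ne')]
  have hNtr : (replaceMarginal (ptB ρ) ν ρ).trace = 1 := by rw [← trace_ptB, hNν, hνtr]
  by_cases hDN : D α (replaceMarginal (ptB ρ) ν ρ) (ν ⊗ₖ σ) = ⊤
  · rw [hDN, EReal.top_add_of_ne_bot (D_ne_bot _ _ _)]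
    exact le_top
  have hN0 : replaceMarginal (ptB ρ) ν ρ ≠ 0 := by
    intro h
    rw [h] at hNtr
    simp at hNtr
  have hQ2 := sandwich_trace_ne_zero hN (hν.kronecker hσ) hN0 hDN
  have hQ := trace_sandwich_chain hα0 hα1 hρ.1 hw hσ ht htr
  rw [← hν_def] at hQ
  have hDρ : D α ρ (w ⊗ₖ σ) = (DR α ρ (w ⊗ₖ σ) : ℝ) := by
    rcases lt_or_gt_of_ne hα1 with h1 | h1
    · apply D_eq_DR_of_sandwich_trace_ne_zero hα0 h1 (hw.kronecker hσ)
      rw [hQ]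
      exact mul_ne_zero (by exact_mod_cast ht.ne') hQ2
    · apply D_eq_DR_of_suppSubset
      have hrw := suppSubset_of_D_ne_top h1 hD
      refine suppSubset_kronecker_of_replaceMarginal hρ.1 hw hν hσ hrw ?_
        (suppSubset_of_D_ne_top h1 hDN)
      rw [hν_def, suppProj_tiltedState hα0 hr.1 hw ht htr]
      exact mul_suppProj_innerSandwich hα0 hα1 hr.1 hw hrw
  rw [hDρ, D_eq_DR_of_ne_top hDN, D_eq_DR_of_ne_top hD, ← EReal.coe_add, EReal.coe_le_coe_iff]
  apply le_of_eq
  have hQ2re : (mpow (mpow (ν ⊗ₖ σ) ((1 - α) / (2 * α)) * replaceMarginal (ptB ρ) ν ρ *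
      mpow (ν ⊗ₖ σ) ((1 - α) / (2 * α))) α).trace.re ≠ 0 := by
    intro h
    have h0 : (0 : ℂ) ≤ _ := (mpow_posSemidef
      (sandwich_posSemidef hN (hν.kronecker hσ) ((1 - α) / (2 * α))) α).trace_nonneg
    rw [Complex.le_def] at h0
    exact hQ2 (Complex.ext h h0.2.symm)
  simp only [DR, hQ, hρ.2, hr.2, hNtr, trace_sandwich_eq hα0 hα1 hr.1 hw, htr, Complex.one_re,
    div_one, Complex.re_ofReal_mul, Complex.ofReal_re]
  rw [Real.logb_mul ht.ne' hQ2re]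
  ring

end Chain

section MaximallyMixed

variable {A C : Type*} [Fintype A] [DecidableEq A] [Fintype C] [DecidableEq C]

/-- The optimized divergence relative to `σ_A ⊗ 𝟙_C` is finite. -/
lemma sInf_D_ne_top [Nonempty A] (α : ℝ) (r : Matrix (A × C) (A × C) ℂ) :
    sInf {x : EReal | ∃ s : Matrix A A ℂ, IsState s ∧
      x = D α r (s ⊗ₖ (1 : Matrix C C ℂ))} ≠ ⊤ := by
  set c : ℝ := (Fintype.card A : ℝ)⁻¹
  have hc : 0 < c := by positivity
  have hs : IsState ((c : ℂ) • (1 : Matrix A A ℂ)) := by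
    refine ⟨Matrix.PosSemidef.one.smul (by exact_mod_cast hc.le), ?_⟩
    simp [c, Matrix.trace_smul]
  refine ne_top_of_le_ne_top ?_ (sInf_le ⟨_, hs, rfl⟩)
  rw [D_eq_DR_of_suppSubset]
  · exact EReal.coe_ne_top _
  · intro v hv
    rw [Matrix.smul_kronecker, Matrix.one_kronecker_one, Matrix.smul_mulVec, Matrix.one_mulVec,
      smul_eq_zero] at hv
    rw [hv.resolve_left (by exact_mod_cast hc.ne'), Matrix.mulVec_zero]

end MaximallyMixed

theorem renyi_conditional_entropy_minfo_chain
    {A B C : Type*} [Fintype A] [DecidableEq A] [Fintype B] [DecidableEq B]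
    [Fintype C] [DecidableEq C]
    (ρ : Matrix ((A × C) × B) ((A × C) × B) ℂ) (hρ : IsState ρ)
    (α : ℝ) (hα : α ∈ Set.Ioo (0 : ℝ) 1 ∪ Set.Ioi (1 : ℝ))
    (ω' : Matrix A A ℂ) (hω' : IsState ω')
    -- `ω'_A` achieves `inf_{σ_A} D_α(ρ_AC‖σ_A⊗𝟙_C)`
    (hopt : D α (ptB ρ) (ω' ⊗ₖ (1 : Matrix C C ℂ))
      = sInf {x : EReal | ∃ s : Matrix A A ℂ, IsState s ∧
          x = D α (ptB ρ) (s ⊗ₖ (1 : Matrix C C ℂ))})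
    (νAC : Matrix (A × C) (A × C) ℂ)
    (hνAC : νAC =
      ((mpow (mpow (ptB ρ) (1 / 2 : ℝ) * mpow (ω' ⊗ₖ (1 : Matrix C C ℂ)) ((1 - α) / α) *
          mpow (ptB ρ) (1 / 2 : ℝ)) α).trace)⁻¹
        • mpow (mpow (ptB ρ) (1 / 2 : ℝ) * mpow (ω' ⊗ₖ (1 : Matrix C C ℂ)) ((1 - α) / α) *
            mpow (ptB ρ) (1 / 2 : ℝ)) α)
    (νABC : Matrix ((A × C) × B) ((A × C) × B) ℂ)
    (hνABC : νABC = ((mpow νAC (1 / 2 : ℝ)) ⊗ₖ (1 : Matrix B B ℂ)) *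
      (((mpow (ptB ρ) (-(1 / 2) : ℝ)) ⊗ₖ (1 : Matrix B B ℂ)) * ρ *
        ((mpow (ptB ρ) (-(1 / 2) : ℝ)) ⊗ₖ (1 : Matrix B B ℂ))) *
      ((mpow νAC (1 / 2 : ℝ)) ⊗ₖ (1 : Matrix B B ℂ))) :
    -- (i)
    (HUp α ((Matrix.reindex (eC_AB A B C) (eC_AB A B C)) ρ)
      ≥ HUp α ((Matrix.reindex (Equiv.prodComm A C) (Equiv.prodComm A C)) (ptB ρ))
        - Idown α νABC)
    ∧
    -- (ii) channel version
    (∀ (R : Type) (_ : Fintype R) (_ : DecidableEq R)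
        (N : Matrix R R ℂ →ₗ[ℂ] Matrix B B ℂ)
        (ρ'' : Matrix ((A × C) × R) ((A × C) × R) ℂ),
      IsCPTP N → IsState ρ'' → (lext N) ρ'' = ρ →
      HUp α ((Matrix.reindex (eC_AB A B C) (eC_AB A B C)) ρ)
        ≥ HUp α ((Matrix.reindex (Equiv.prodComm A C) (Equiv.prodComm A C)) (ptB ρ''))
          - sSup {x : EReal | ∃ ω : Matrix ((A × C) × R) ((A × C) × R) ℂ,
              IsState ω ∧ x = Idown α ((lext N) ω)}) := by
  have hα0 : 0 < α := by
    rcases hα with h | h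
    · exact h.1
    · exact one_pos.trans h
  have hα1 : α ≠ 1 := by
    rcases hα with h | h
    · exact h.2.ne
    · exact (Set.mem_Ioi.1 h).ne'
  have hA : Nonempty A := by
    by_contra h
    rw [not_nonempty_iff] at h
    simpa [Matrix.trace] using hω'.2
  have hr : IsState (ptB ρ) := ⟨ptB_posSemidef hρ.1, (trace_ptB ρ).trans hρ.2⟩
  have hw : (ω' ⊗ₖ (1 : Matrix C C ℂ)).PosSemidef := hω'.1.kronecker Matrix.PosSemidef.one
  have hD : D α (ptB ρ) (ω' ⊗ₖ (1 : Matrix C C ℂ)) ≠ ⊤ := hopt ▸ sInf_D_ne_top α (ptB ρ)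
  have hν_def : νAC = tiltedState α (ptB ρ) (ω' ⊗ₖ (1 : Matrix C C ℂ)) := hνAC
  have hνABC' : νABC = replaceMarginal (ptB ρ) νAC ρ := hνABC
  have hν : νAC.PosSemidef := hν_def ▸ tiltedState_posSemidef hr.1 hw
  obtain ⟨t, ht, htr⟩ := exists_trace_innerSandwich hα0 hα1 hr hw hD
  have hνr : νAC * suppProj (ptB ρ) = νAC :=
    hν_def ▸ tiltedState_mul_suppProj hα0 hr.1 hw ht htr
  have hνtr : νAC.trace = 1 := by
    rw [hν_def, tiltedState, Matrix.trace_smul, htr, smul_eq_mul,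
      inv_mul_cancel₀ (by exact_mod_cast ht.ne')]
  have hHAC : HUp α ((Matrix.reindex (Equiv.prodComm A C) (Equiv.prodComm A C)) (ptB ρ))
      = -D α (ptB ρ) (ω' ⊗ₖ (1 : Matrix C C ℂ)) := by
    rw [hopt, HUp]
    congr 2
    ext x
    refine exists_congr fun s => and_congr_right fun hs => ?_
    rw [← D_reindex hr.1 (hs.1.kronecker Matrix.PosSemidef.one) (Equiv.prodComm A C)]
    congr! 2
    ext p q
    exact mul_comm _ _
  have hchain : HUp α ((Matrix.reindex (eC_AB A B C) (eC_AB A B C)) ρ)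
      ≥ HUp α ((Matrix.reindex (Equiv.prodComm A C) (Equiv.prodComm A C)) (ptB ρ))
        - Idown α νABC := by
    have hνptB : ptB νABC = νAC := by rw [hνABC', ptB_replaceMarginal hr.1 hν rfl hνr]
    rw [hHAC, HUp, ge_iff_le, D_eq_DR_of_ne_top hD, ← EReal.neg_add
      (Or.inl (EReal.coe_ne_bot _)) (Or.inl (EReal.coe_ne_top _)), EReal.neg_le_neg_iff, add_comm,
      ← EReal.sub_le_iff_le_add (Or.inl (EReal.coe_ne_bot _)) (Or.inl (EReal.coe_ne_top _)), Idown,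
      hνptB]
    refine le_sInf ?_
    rintro _ ⟨σ, hσ, rfl⟩
    rw [EReal.sub_le_iff_le_add (Or.inl (EReal.coe_ne_bot _)) (Or.inl (EReal.coe_ne_top _)),
      ← D_eq_DR_of_ne_top hD, hνABC']
    refine le_trans (sInf_le ⟨ω' ⊗ₖ σ, ⟨hω'.1.kronecker hσ.1, ?_⟩, rfl⟩)
      (le_trans (le_of_eq ?_) (D_kronecker_le hα0 hα1 hρ hw hD hσ.1 hν_def))
    · rw [Matrix.trace_kronecker, hω'.2, hσ.2, one_mul]
    · rw [← D_reindex hρ.1 (hw.kronecker hσ.1) (eC_AB A B C)]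
      congr 1
      ext p q
      exact (mul_left_comm _ _ _).trans (mul_assoc _ _ _).symm
  refine ⟨hchain, ?_⟩
  intro R _ _ N ρ'' hN hρ'' hNρ
  have hmarg : ptB ρ'' = ptB ρ := by rw [← hNρ, ptB_lext hN.tp]
  rw [hmarg]
  refine le_trans (EReal.sub_le_sub le_rfl (le_sSup ⟨replaceMarginal (ptB ρ) νAC ρ'', ⟨?_, ?_⟩, ?_⟩))
    hchain
  · exact replaceMarginal_posSemidef hr.1 hν hρ''.1
  · rw [← trace_ptB, ptB_replaceMarginal hr.1 hν hmarg hνr, hνtr]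
  · rw [lext_replaceMarginal, hNρ, hνABC']

end QITLeak
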